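/- Let 1 ≤ s < n and A ∈ Mat_{(s+1)×(n−s)}(ℝ) with ω_j(A) < n for every j = 1, …, n−s. Then there exist constants θ > 0 and K_4 > 0, depending only on A, such that for every 1 ≤ k ≤ n−s and every w ∈ ⋀^k(ℤ^{n+1}) with π_•(w) ≠ 0, one has ‖R_A c(w)‖ ≥ K_4 ‖π_•(w)‖^{−((n−θ)+1−k)/k}. -/

import Mathlib

open MeasureTheory Metric Set
open scoped BigOperators ENNReal

noncomputable section

/-- `x̃ = (1, x)` -/
def tilde {s : ℕ} (x : Fin s → ℝ) : Fin (s + 1) → ℝ := Fin.cons 1 x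

/-- The parametrization `x ↦ (x, x̃A)` of the affine subspace. -/
def phiA {s m : ℕ} (A : Matrix (Fin (s + 1)) (Fin m) ℝ) (x : Fin s → ℝ) :
    Fin (s + m) → ℝ :=
  Fin.append x (Matrix.vecMul (tilde x) A)

/-- `(x, x̃A) · q + p`. -/
def dotA {s m : ℕ} (A : Matrix (Fin (s + 1)) (Fin m) ℝ) (x : Fin s → ℝ)
    (q : Fin (s + m) → ℤ) : ℝ :=
  ∑ j, phiA A x j * (q j : ℝ)

/-- The gradient `[Id_s A'] q` of `x ↦ (x, x̃A)·q`. -/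
def gradA {s m : ℕ} (A : Matrix (Fin (s + 1)) (Fin m) ℝ) (q : Fin (s + m) → ℤ) :
    Fin s → ℝ :=
  fun i => (q (Fin.castAdd m i) : ℝ) + ∑ j, A i.succ j * (q (Fin.natAdd s j) : ℝ)

/-- Coordinate `⟨e_i ∧ e_J, w⟩` of the map `c` (zero unless `J ⊆ {1,…,n}` and `i ∉ J`). -/
def cMap {n : ℕ} (w : Finset (Fin (n + 1)) → ℝ) (i : Fin (n + 1))
    (J : Finset (Fin (n + 1))) : ℝ :=
  if (0 : Fin (n + 1)) ∈ J ∨ i ∈ J then 0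
  else (-1 : ℝ) ^ (J.filter (· < i)).card * w (insert i J)

/-- The matrix `R_A = (Id_{s+1} | A)`. -/
def RA {s m : ℕ} (A : Matrix (Fin (s + 1)) (Fin m) ℝ) :
    Matrix (Fin (s + 1)) (Fin (s + m + 1)) ℝ :=
  fun a i =>
    if h : (i : ℕ) < s + 1 then (if (i : ℕ) = (a : ℕ) then 1 else 0)
    else A a ⟨(i : ℕ) - (s + 1), by omega⟩

/-- Coordinates of `R_A c(w)`. -/
def RAc {s m : ℕ} (A : Matrix (Fin (s + 1)) (Fin m) ℝ)
    (w : Finset (Fin (s + m + 1)) → ℝ) (a : Fin (s + 1)) (J : Finset (Fin (s + m + 1))) : ℝ :=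
  ∑ i, RA A a i * cMap w i J

/-- Euclidean norm of `R_A c(w)`. -/
def RAcNorm {s m : ℕ} (A : Matrix (Fin (s + 1)) (Fin m) ℝ)
    (w : Finset (Fin (s + m + 1)) → ℝ) : ℝ :=
  Real.sqrt (∑ a, ∑ J, (RAc A w a J) ^ 2)

/-- Euclidean norm of the projection `π_•(w)` onto `⋀(W_{s+1→n})`. -/
def pibullNorm (s : ℕ) {n : ℕ} (w : Finset (Fin (n + 1)) → ℝ) : ℝ :=
  Real.sqrt (∑ S : Finset (Fin (n + 1)),
    if ∀ i ∈ S, s < (i : ℕ) then (w S) ^ 2 else 0)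

/-- Euclidean norm of an exterior vector in coordinates. -/
def extNorm {N : ℕ} (w : Finset (Fin N) → ℝ) : ℝ :=
  Real.sqrt (∑ S : Finset (Fin N), (w S) ^ 2)

/-- Euclidean norm of the projection `π(w)` onto `⋀(W_{1→n})`. -/
def piNorm {n : ℕ} (w : Finset (Fin (n + 1)) → ℝ) : ℝ :=
  Real.sqrt (∑ S : Finset (Fin (n + 1)),
    if (0 : Fin (n + 1)) ∉ S then (w S) ^ 2 else 0)

/-- `w` has pure degree `k`. -/
def ExtDeg {N : ℕ} (k : ℕ) (w : Finset (Fin N) → ℝ) : Prop :=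
  ∀ S, S.card ≠ k → w S = 0

/-- The set of exponents `v` appearing in the definition of `ω_j(A)`. -/
def expSet (s m : ℕ) (A : Matrix (Fin (s + 1)) (Fin m) ℝ) (j : ℕ) : Set ℝ :=
  {v | 0 < v ∧ ∀ M : ℝ, ∃ w : Finset (Fin (s + m + 1)) → ℤ,
    (∀ S, S.card ≠ j → w S = 0) ∧
    M < pibullNorm s (fun S => (w S : ℝ)) ∧
    RAcNorm A (fun S => (w S : ℝ)) <
      pibullNorm s (fun S => (w S : ℝ)) ^ (-(v + 1 - j) / j)}

/-- `ω_j(A) < n` for all `j = 1, …, n − s`  (here `n = s + m`). -/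
def DiophCond (s m : ℕ) (A : Matrix (Fin (s + 1)) (Fin m) ℝ) : Prop :=
  ∀ j : ℕ, 1 ≤ j → j ≤ m → ∃ v : ℝ, v < (s + m : ℕ) ∧ ∀ u ∈ expSet s m A j, u ≤ v

/-- Action of a matrix on exterior coordinates (compound matrix action). -/
def extAction {N : ℕ} (M : Matrix (Fin N) (Fin N) ℝ) (w : Finset (Fin N) → ℝ) :
    Finset (Fin N) → ℝ :=
  fun S => ∑ T : Finset (Fin N),
    if h : T.card = S.card then
      (Matrix.of fun a b : Fin S.card =>
          M (S.orderEmbOfFin rfl a) (T.orderEmbOfFin h b)).det * w T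
    else 0

/-- The wedge `v_1 ∧ ⋯ ∧ v_k` of vectors, in coordinates. -/
def wedgeOf {N k : ℕ} (v : Fin k → (Fin N → ℝ)) : Finset (Fin N) → ℝ :=
  fun S =>
    if h : S.card = k then
      (Matrix.of fun a b : Fin k => v a (S.orderEmbOfFin h b)).det
    else 0

/-- Sign for the wedge product of basis monomials. -/
def wedgeSign {N : ℕ} (T T' : Finset (Fin N)) : ℝ :=
  (-1) ^ (∑ a ∈ T, (T'.filter (· < a)).card)

/-- The wedge (exterior) product in coordinates. -/
def wedgeMul {N : ℕ} (u w : Finset (Fin N) → ℝ) : Finset (Fin N) → ℝ :=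
  fun S => ∑ T ∈ S.powerset, wedgeSign T (S \ T) * u T * w (S \ T)

/-- The unipotent matrix `u_x` on `ℝ^{1+s+n}`, `n = s+m`, with block rows
`(1, 0, x, x̃A)`, `(0, I_s, I_s, A')`, `(0, 0, I_n)`. -/
def uMat {s m : ℕ} (A : Matrix (Fin (s + 1)) (Fin m) ℝ) (x : Fin s → ℝ) :
    Matrix (Fin (1 + s + (s + m))) (Fin (1 + s + (s + m))) ℝ :=
  fun i j =>
    if (i : ℕ) = 0 then
      if (j : ℕ) = 0 then 1
      else if h1 : (j : ℕ) < 1 + s then 0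
      else if h2 : (j : ℕ) < 1 + s + s then x ⟨(j : ℕ) - (1 + s), by omega⟩
      else ∑ a, tilde x a * A a ⟨(j : ℕ) - (1 + s + s), by have := j.isLt; omega⟩
    else if hi : (i : ℕ) < 1 + s then
      if (j : ℕ) = 0 then 0
      else if h1 : (j : ℕ) < 1 + s then (if (j : ℕ) = (i : ℕ) then 1 else 0)
      else if h2 : (j : ℕ) < 1 + s + s then (if (j : ℕ) = (i : ℕ) + s then 1 else 0)
      else A ⟨(i : ℕ), by omega⟩ ⟨(j : ℕ) - (1 + s + s), by have := j.isLt; omega⟩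
    else if j = i then 1 else 0

/-- The diagonal matrix `g_t = diag(ε/δ, ε/K, …, ε/K, ε/T, …, ε/T)` on `ℝ^{1+s+n}`. -/
def gMat (s m : ℕ) (δ K T ε : ℝ) :
    Matrix (Fin (1 + s + (s + m))) (Fin (1 + s + (s + m))) ℝ :=
  Matrix.diagonal fun i =>
    if (i : ℕ) = 0 then ε / δ else if (i : ℕ) < 1 + s then ε / K else ε / T

/-- The vector `(p, 0, …, 0, q) ∈ Λ ⊂ ℤ^{1+s+n}`. -/
def lamVec (s m : ℕ) (p : ℤ) (q : Fin (s + m) → ℤ) : Fin (1 + s + (s + m)) → ℝ :=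
  fun i =>
    if (i : ℕ) = 0 then (p : ℝ)
    else if h : (i : ℕ) < 1 + s then 0
    else (q ⟨(i : ℕ) - (1 + s), by have := i.isLt; omega⟩ : ℝ)

/-- The matrix `ũ_x` on `ℝ^{n+1}`, with block rows `(1, x, x̃A)` and `(0, I_n)`. -/
def utMat {s m : ℕ} (A : Matrix (Fin (s + 1)) (Fin m) ℝ) (x : Fin s → ℝ) :
    Matrix (Fin (s + m + 1)) (Fin (s + m + 1)) ℝ :=
  fun i j =>
    if (i : ℕ) = 0 then
      if h : (j : ℕ) = 0 then 1
      else phiA A x ⟨(j : ℕ) - 1, by have := j.isLt; omega⟩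
    else if j = i then 1 else 0

/-- The diagonal matrix `g̃_t = diag(ε/δ, ε/T, …, ε/T)` on `ℝ^{n+1}`. -/
def gtMat (s m : ℕ) (δ T ε : ℝ) : Matrix (Fin (s + m + 1)) (Fin (s + m + 1)) ℝ :=
  Matrix.diagonal fun i => if (i : ℕ) = 0 then ε / δ else ε / T

/-- The function `ν(w) = ‖π_*(w)‖`: the euclidean norm of the part of `w` involving at most
one of the starred basis vectors `e_{*1}, …, e_{*s}` (indices `1, …, s` of `ℝ^{1+s+n}`). -/
def nuFun (s m : ℕ) (w : Finset (Fin (1 + s + (s + m))) → ℝ) : ℝ :=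
  Real.sqrt (∑ S : Finset (Fin (1 + s + (s + m))),
    if (S.filter fun i : Fin (1 + s + (s + m)) => 1 ≤ (i : ℕ) ∧ (i : ℕ) < 1 + s).card ≤ 1
    then (w S) ^ 2 else 0)

/-- `δ := κ/2^{nt}`. -/
def deltaP (s m : ℕ) (κ : ℝ) (t : ℕ) : ℝ := κ / 2 ^ ((s + m) * t)

/-- `K := √(ns/(2r²))·2^{t/2}`. -/
def KofT (s m : ℕ) (r : ℝ) (t : ℕ) : ℝ :=
  Real.sqrt (((s + m : ℕ) : ℝ) * s / (2 * r ^ 2)) * 2 ^ ((t : ℝ) / 2)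

/-- `T := 2^{t+1}`. -/
def TofT (t : ℕ) : ℝ := 2 ^ (t + 1)

/-- `ε' := (δKT^{n−1})^{1/(n+1)}`. -/
def epsP' (s m : ℕ) (κ r : ℝ) (t : ℕ) : ℝ :=
  (deltaP s m κ t * KofT s m r t * TofT t ^ (s + m - 1)) ^ (1 / ((s + m : ℕ) + 1 : ℝ))

/-- `ε := 2^{βt} ε'`. -/
def epsP (s m : ℕ) (κ r β : ℝ) (t : ℕ) : ℝ :=
  (2 : ℝ) ^ (β * t) * epsP' s m κ r t

/-- `‖ỹ c(w)‖` where `ỹ = (1, x, x̃A) = x̃ R_A`. -/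
def ycNorm {s m : ℕ} (A : Matrix (Fin (s + 1)) (Fin m) ℝ) (x : Fin s → ℝ)
    (w : Finset (Fin (s + m + 1)) → ℝ) : ℝ :=
  Real.sqrt (∑ J : Finset (Fin (s + m + 1)),
    (∑ i, (Fin.cons (1 : ℝ) (phiA A x) : Fin (s + m + 1) → ℝ) i * cMap w i J) ^ 2)

/-- A function is `(C, α)`-good on `V ⊆ ℝ^s`. -/
def IsGood (s : ℕ) (C α : ℝ) (f : EuclideanSpace ℝ (Fin s) → ℝ)
    (V : Set (EuclideanSpace ℝ (Fin s))) : Prop :=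
  ∀ (y₀ : EuclideanSpace ℝ (Fin s)) (r : ℝ), 0 < r → ball y₀ r ⊆ V →
    ∀ ε : ℝ, 0 < ε →
      volume {x ∈ ball y₀ r | |f x| < ε} ≤
        ENNReal.ofReal (C * (ε / sSup ((fun y => |f y|) '' ball y₀ r)) ^ α) *
          volume (ball y₀ r)

/-- `V_s`: the volume of the `s`-dimensional euclidean unit ball. -/
def Vball (s : ℕ) : ℝ := (volume (ball (0 : EuclideanSpace ℝ (Fin s)) 1)).toReal

/-- `N_s`: the Besicovitch covering constant of `ℝ^s`. -/
def Nbes (s : ℕ) : ℕ := Besicovitch.multiplicity (EuclideanSpace ℝ (Fin s))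

/-- `K_s := 4^{2s+1} s^{s/2} N_s / V_s`. -/
def Kcst (s : ℕ) : ℝ :=
  4 ^ (2 * s + 1) * (s : ℝ) ^ ((s : ℝ) / 2) * (Nbes s : ℝ) / Vball s

/-- `Γ` is a primitive subgroup of `Λ`: `Γ ≤ Λ` and `Γ_ℝ ∩ Λ = Γ`. -/
def IsPrimitiveIn {d : ℕ} (Λ Γ : Submodule ℤ (Fin d → ℝ)) : Prop :=
  Γ ≤ Λ ∧
    (Submodule.span ℝ (Γ : Set (Fin d → ℝ))).restrictScalars ℤ ⊓ Λ = Γ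

/-- `u` is a basis of the discrete subgroup `Γ` (so `u₁ ∧ ⋯ ∧ u_j` represents `Γ`). -/
def Represents {d j : ℕ} (u : Fin j → (Fin d → ℝ)) (Γ : Submodule ℤ (Fin d → ℝ)) : Prop :=
  LinearIndependent ℝ u ∧ Submodule.span ℤ (Set.range u) = Γ

/-- `w = v₁ ∧ ⋯ ∧ v_k` represents the nonzero primitive rank-`k` subgroup of `ℤ^N`
generated by `v₁, …, v_k`. -/
def RepresentsPrimInt {N k : ℕ} (v : Fin k → (Fin N → ℤ)) (w : Finset (Fin N) → ℝ) : Prop :=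
  LinearIndependent ℝ (fun a => fun i => ((v a i : ℝ))) ∧
  (∀ z : Fin N → ℤ,
      ((fun i => (z i : ℝ)) ∈
        Submodule.span ℝ (Set.range fun a => fun i => ((v a i : ℝ)))) →
      z ∈ Submodule.span ℤ (Set.range v)) ∧
  w = wedgeOf fun a => fun i => ((v a i : ℝ))

theorem abs_le_pibullNorm {s n : ℕ} (w : Finset (Fin (n + 1)) → ℝ) {S : Finset (Fin (n + 1))}
    (hS : ∀ i ∈ S, s < (i : ℕ)) : |w S| ≤ pibullNorm s w := by
  refine Real.abs_le_sqrt ?_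
  have h := Finset.single_le_sum (s := Finset.univ)
    (f := fun S : Finset (Fin (n + 1)) => if ∀ i ∈ S, s < (i : ℕ) then (w S) ^ 2 else 0)
    (fun T _ => by positivity) (Finset.mem_univ S)
  simpa [if_pos hS] using h

theorem abs_RAc_le_RAcNorm {s m : ℕ} (A : Matrix (Fin (s + 1)) (Fin m) ℝ)
    (w : Finset (Fin (s + m + 1)) → ℝ) (a : Fin (s + 1)) (J : Finset (Fin (s + m + 1))) :
    |RAc A w a J| ≤ RAcNorm A w := by
  refine Real.abs_le_sqrt ?_
  calc (RAc A w a J) ^ 2 ≤ ∑ J, (RAc A w a J) ^ 2 :=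
        Finset.single_le_sum (f := fun J => (RAc A w a J) ^ 2) (fun T _ => sq_nonneg _)
          (Finset.mem_univ J)
    _ ≤ _ := Finset.single_le_sum (f := fun a => ∑ J, (RAc A w a J) ^ 2)
          (fun T _ => Finset.sum_nonneg fun _ _ => sq_nonneg _) (Finset.mem_univ a)

theorem abs_cMap_le {n : ℕ} (w : Finset (Fin (n + 1)) → ℝ) (i : Fin (n + 1))
    (J : Finset (Fin (n + 1))) : |cMap w i J| ≤ |w (insert i J)| := by
  unfold cMap
  split_ifs <;> simp

theorem abs_cMap_of_notMem {n : ℕ} (w : Finset (Fin (n + 1)) → ℝ) {i : Fin (n + 1)}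
    {J : Finset (Fin (n + 1))} (h0 : (0 : Fin (n + 1)) ∉ J) (hi : i ∉ J) :
    |cMap w i J| = |w (insert i J)| := by
  simp [cMap, h0, hi]

/-- A coordinate whose smallest index is at most `s` is controlled by `R_A c(w)` and by the
coordinates in which that index is replaced by one larger than `s`. -/
theorem abs_insert_le {s m : ℕ} (A : Matrix (Fin (s + 1)) (Fin m) ℝ)
    (w : Finset (Fin (s + m + 1)) → ℝ) {B : ℝ} (hB : 0 ≤ B) {a : Fin (s + m + 1)}
    (has : (a : ℕ) < s + 1) {J : Finset (Fin (s + m + 1))} (h0 : (0 : Fin (s + m + 1)) ∉ J)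
    (haJ : a ∉ J) (hJ : ∀ i : Fin (s + m + 1), s < (i : ℕ) → |w (insert i J)| ≤ B) :
    |w (insert a J)| ≤ RAcNorm A w + (∑ b, ∑ i, |RA A b i|) * B := by
  have hsplit : RAc A w ⟨a, has⟩ J =
      cMap w a J + ∑ i ∈ Finset.univ.erase a, RA A ⟨a, has⟩ i * cMap w i J := by
    rw [RAc, ← Finset.add_sum_erase _ _ (Finset.mem_univ a)]
    simp [RA, has]
  have hrest : |∑ i ∈ Finset.univ.erase a, RA A ⟨a, has⟩ i * cMap w i J| ≤
      (∑ b, ∑ i, |RA A b i|) * B := by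
    calc _ ≤ ∑ i ∈ Finset.univ.erase a, |RA A ⟨a, has⟩ i| * B := by
          refine (Finset.abs_sum_le_sum_abs _ _).trans (Finset.sum_le_sum fun i hi => ?_)
          rw [abs_mul]
          by_cases his : (i : ℕ) < s + 1
          · have : (i : ℕ) ≠ a := fun h => (Finset.mem_erase.1 hi).1 (Fin.ext h)
            simp [RA, his, this]
          · exact mul_le_mul_of_nonneg_left ((abs_cMap_le w i J).trans (hJ i (by omega)))
              (abs_nonneg _)
      _ ≤ ∑ i, |RA A ⟨a, has⟩ i| * B :=
          Finset.sum_le_univ_sum_of_nonneg fun i => by positivity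
      _ ≤ _ := by
          rw [← Finset.sum_mul]
          gcongr
          exact Finset.single_le_sum (f := fun b => ∑ i, |RA A b i|)
            (fun b _ => Finset.sum_nonneg fun _ _ => abs_nonneg _) (Finset.mem_univ _)
  rw [← abs_cMap_of_notMem w h0 haJ, eq_sub_of_add_eq hsplit.symm]
  exact (abs_sub _ _).trans (add_le_add (abs_RAc_le_RAcNorm A w _ J) hrest)

theorem exists_abs_le_of_card_filter_le {s m : ℕ} (A : Matrix (Fin (s + 1)) (Fin m) ℝ) (M : ℝ)
    (r : ℕ) :
    ∃ B : ℝ, 0 ≤ B ∧ ∀ w : Finset (Fin (s + m + 1)) → ℝ, pibullNorm s w ≤ M →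
      RAcNorm A w ≤ 1 → ∀ S : Finset (Fin (s + m + 1)),
        (S.filter fun i : Fin (s + m + 1) => (i : ℕ) < s + 1).card ≤ r → |w S| ≤ B := by
  induction r with
  | zero =>
    refine ⟨max M 0, le_max_right _ _, fun w hw _ S hS => ?_⟩
    rw [Nat.le_zero, Finset.card_eq_zero, Finset.filter_eq_empty_iff] at hS
    exact (abs_le_pibullNorm w fun i hi => by have := hS hi; omega).trans
      (hw.trans (le_max_left _ _))
  | succ r ih =>
    obtain ⟨B, hB, h⟩ := ih
    refine ⟨max B (1 + (∑ b, ∑ i, |RA A b i|) * B), hB.trans (le_max_left _ _),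
      fun w hw hR S hS => ?_⟩
    by_cases hr : (S.filter fun i : Fin (s + m + 1) => (i : ℕ) < s + 1).card ≤ r
    · exact (h w hw hR S hr).trans (le_max_left _ _)
    obtain ⟨x, hx⟩ := Finset.card_pos.1 (Nat.zero_lt_of_lt (not_le.1 hr))
    rw [Finset.mem_filter] at hx
    have hne : S.Nonempty := ⟨x, hx.1⟩
    have haS := S.min'_mem hne
    have hax := S.min'_le x hx.1
    have h0 : S.min' hne = 0 ∨ (0 : Fin (s + m + 1)) ∉ S :=
      or_iff_not_imp_right.2 fun hS => le_antisymm (S.min'_le 0 (not_not.1 hS)) (Fin.zero_le _)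
    generalize S.min' hne = a at haS hax h0
    have has : (a : ℕ) < s + 1 := lt_of_le_of_lt hax hx.2
    have key := abs_insert_le A w hB has (J := S.erase a)
      (by
        rcases h0 with rfl | h0
        · simp
        · simp [h0])
      (Finset.notMem_erase a S) fun i hi => h w hw hR _ <| by
        rw [Finset.filter_insert, if_neg (by omega), Finset.filter_erase,
          Finset.card_erase_of_mem (Finset.mem_filter.2 ⟨haS, has⟩)]
        omega
    rw [Finset.insert_erase haS] at key
    exact key.trans ((add_le_add_left hR _).trans (le_max_right _ _))

theorem finite_pibullNorm_le_RAcNorm_le_one {s m : ℕ} (A : Matrix (Fin (s + 1)) (Fin m) ℝ)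
    (M : ℝ) :
    {w : Finset (Fin (s + m + 1)) → ℤ | pibullNorm s (fun S => (w S : ℝ)) ≤ M ∧
      RAcNorm A (fun S => (w S : ℝ)) ≤ 1}.Finite := by
  obtain ⟨B, -, h⟩ := exists_abs_le_of_card_filter_le A M (s + m + 1)
  refine (Set.finite_Icc (fun _ => -⌊B⌋) (fun _ => ⌊B⌋)).subset fun w hw => ?_
  have hle (S) : |w S| ≤ ⌊B⌋ := by
    rw [Int.le_floor, Int.cast_abs]
    exact h _ hw.1 hw.2 S ((Finset.card_le_univ _).trans (by simp))
  exact ⟨fun S => (abs_le.1 (hle S)).1, fun S => (abs_le.1 (hle S)).2⟩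

theorem exists_pos_le_RAcNorm {s m : ℕ} (A : Matrix (Fin (s + 1)) (Fin m) ℝ) (M : ℝ) :
    ∃ c > (0 : ℝ), ∀ w : Finset (Fin (s + m + 1)) → ℤ, pibullNorm s (fun S => (w S : ℝ)) ≤ M →
      RAcNorm A (fun S => (w S : ℝ)) ≠ 0 → c ≤ RAcNorm A (fun S => (w S : ℝ)) := by
  have hfin := finite_pibullNorm_le_RAcNorm_le_one A M
  have hev : ∀ᶠ c : ℝ in nhdsWithin 0 (Set.Ioi 0), ∀ w ∈ {w : Finset (Fin (s + m + 1)) → ℤ |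
      pibullNorm s (fun S => (w S : ℝ)) ≤ M ∧ RAcNorm A (fun S => (w S : ℝ)) ≤ 1},
      RAcNorm A (fun S => (w S : ℝ)) ≠ 0 → c ≤ RAcNorm A (fun S => (w S : ℝ)) := by
    rw [Filter.eventually_all_finite hfin]
    intro w _
    by_cases h : RAcNorm A (fun S => (w S : ℝ)) = 0
    · simp [h]
    · have hpos : 0 < RAcNorm A (fun S => (w S : ℝ)) := (Real.sqrt_nonneg _).lt_of_ne' h
      filter_upwards [Ioc_mem_nhdsGT hpos] with c hc _ using hc.2
  obtain ⟨c, hc, hc0, hc1⟩ := (hev.and (Ioc_mem_nhdsGT one_pos)).exists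
  refine ⟨c, hc0, fun w hw hne => ?_⟩
  rcases le_total (RAcNorm A (fun S => (w S : ℝ))) 1 with h | h
  · exact hc w ⟨hw, h⟩ hne
  · exact hc1.trans h

theorem pibullNorm_const_mul (s : ℕ) {n : ℕ} {c : ℝ} (hc : 0 ≤ c)
    (w : Finset (Fin (n + 1)) → ℝ) :
    pibullNorm s (fun S => c * w S) = c * pibullNorm s w := by
  simp only [pibullNorm, mul_pow]
  rw [← Real.sqrt_sq hc, ← Real.sqrt_mul (sq_nonneg c), Real.sqrt_sq hc, Finset.mul_sum]
  simp only [mul_ite, mul_zero]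

theorem RAcNorm_const_mul {s m : ℕ} (A : Matrix (Fin (s + 1)) (Fin m) ℝ) {c : ℝ} (hc : 0 ≤ c)
    (w : Finset (Fin (s + m + 1)) → ℝ) :
    RAcNorm A (fun S => c * w S) = c * RAcNorm A w := by
  have h (a J) : RAc A (fun S => c * w S) a J = c * RAc A w a J := by
    rw [RAc, RAc, Finset.mul_sum]
    refine Finset.sum_congr rfl fun i _ => ?_
    unfold cMap
    split_ifs <;> ring
  simp only [RAcNorm, h, mul_pow, ← Finset.mul_sum]
  rw [Real.sqrt_mul (sq_nonneg c), Real.sqrt_sq hc]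

theorem one_le_pibullNorm {s n : ℕ} {w : Finset (Fin (n + 1)) → ℤ}
    (h : pibullNorm s (fun S => (w S : ℝ)) ≠ 0) : 1 ≤ pibullNorm s (fun S => (w S : ℝ)) := by
  obtain ⟨S, hS, hw⟩ : ∃ S : Finset (Fin (n + 1)), (∀ i ∈ S, s < (i : ℕ)) ∧ w S ≠ 0 := by
    by_contra! hcon
    refine h ?_
    rw [pibullNorm, Finset.sum_eq_zero, Real.sqrt_zero]
    intro S _
    split_ifs with hS
    · simp [hcon S hS]
    · rfl
  refine le_trans ?_ (abs_le_pibullNorm (fun S => (w S : ℝ)) hS)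
  exact_mod_cast Int.one_le_abs hw

theorem exists_RAcNorm_lower_bound {s m k : ℕ} {A : Matrix (Fin (s + 1)) (Fin m) ℝ} {v : ℝ}
    (hv : 0 < v) (hkv : k ≤ v + 1) (hvA : v ∉ expSet s m A k) :
    ∃ K > (0 : ℝ), ∀ w : Finset (Fin (s + m + 1)) → ℤ, (∀ S, S.card ≠ k → w S = 0) →
      pibullNorm s (fun S => (w S : ℝ)) ≠ 0 →
      K * pibullNorm s (fun S => (w S : ℝ)) ^ (-(v + 1 - k) / k) ≤
        RAcNorm A (fun S => (w S : ℝ)) := by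
  simp only [expSet, Set.mem_ofPred_eq, hv, true_and] at hvA
  push Not at hvA
  obtain ⟨M, hM⟩ := hvA
  obtain ⟨c, hc, hcA⟩ := exists_pos_le_RAcNorm A M
  refine ⟨min c 1, lt_min hc one_pos, fun w hw hne => ?_⟩
  have hone := one_le_pibullNorm hne
  have hpow : 0 ≤ pibullNorm s (fun S => (w S : ℝ)) ^ (-(v + 1 - k) / k) := by positivity
  rcases lt_or_ge M (pibullNorm s (fun S => (w S : ℝ))) with h | h
  · exact (mul_le_of_le_one_left hpow (min_le_right _ _)).trans (hM w hw h)
  have hexp : (-(v + 1 - k) / k : ℝ) ≤ 0 :=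
    div_nonpos_of_nonpos_of_nonneg (by linarith) k.cast_nonneg
  have hR : RAcNorm A (fun S => (w S : ℝ)) ≠ 0 := by
    intro hzero
    obtain ⟨N, hN⟩ := exists_nat_gt (max M 0)
    have hN0 : (0 : ℝ) < N := (le_max_right _ _).trans_lt hN
    have hcast : (fun S => (((N : ℤ) * w S : ℤ) : ℝ)) = fun S => (N : ℝ) * (w S : ℝ) := by
      ext S
      push_cast
      rfl
    have hbull : (N : ℝ) ≤ pibullNorm s (fun S => (((N : ℤ) * w S : ℤ) : ℝ)) := by
      rw [hcast, pibullNorm_const_mul s hN0.le]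
      exact le_mul_of_one_le_right hN0.le hone
    have hlow := hM (fun S => (N : ℤ) * w S) (fun S hS => by simp [hw S hS])
      (((le_max_left _ _).trans_lt hN).trans_le hbull)
    have hpos := Real.rpow_pos_of_pos (hN0.trans_le hbull) (-(v + 1 - k) / k)
    rw [show RAcNorm A (fun S => (((N : ℤ) * w S : ℤ) : ℝ)) = 0 by
      rw [hcast, RAcNorm_const_mul A hN0.le, hzero, mul_zero]] at hlow
    exact hpos.not_ge hlow
  calc _ ≤ min c 1 := mul_le_of_le_one_right (lt_min hc one_pos).le
          (Real.rpow_le_one_of_one_le_of_nonpos hone hexp)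
    _ ≤ c := min_le_left _ _
    _ ≤ _ := hcA w h hR

/-- A consequence of the condition `ω_j(A) < n`: there are `θ, K₄ > 0`, depending only
on `A`, with `‖R_A c(w)‖ ≥ K₄ ‖π_•(w)‖^{-((n-θ)+1-k)/k}` for all `1 ≤ k ≤ n - s` and all
`w ∈ ⋀^k(ℤ^{n+1})` with `π_•(w) ≠ 0` (here `n = s + m`). -/
theorem RAc_lower_bound_of_dioph (s m : ℕ) (hs : 1 ≤ s) (hm : 1 ≤ m)
    (A : Matrix (Fin (s + 1)) (Fin m) ℝ) (hA : DiophCond s m A) :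
    ∃ θ > (0 : ℝ), ∃ K4 > (0 : ℝ),
      ∀ k : ℕ, 1 ≤ k → k ≤ m →
      ∀ w : Finset (Fin (s + m + 1)) → ℤ,
        (∀ S, S.card ≠ k → w S = 0) →
        pibullNorm s (fun S => (w S : ℝ)) ≠ 0 →
        K4 * pibullNorm s (fun S => (w S : ℝ)) ^
            (-((((s + m : ℕ) : ℝ) - θ) + 1 - k) / k) ≤
          RAcNorm A (fun S => (w S : ℝ)) := by
  have hsm : (1 : ℝ) ≤ s ∧ (1 : ℝ) ≤ m := ⟨by exact_mod_cast hs, by exact_mod_cast hm⟩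
  have hθ : ∀ᶠ θ : ℝ in nhdsWithin 0 (Set.Ioi 0), ∀ k ∈ Finset.Icc 1 m,
      ((s + m : ℕ) : ℝ) - θ ∉ expSet s m A k := by
    rw [Filter.eventually_all_finset]
    intro k hk
    obtain ⟨hk1, hkm⟩ := Finset.mem_Icc.1 hk
    obtain ⟨v, hv, hvA⟩ := hA k hk1 hkm
    filter_upwards [Ioo_mem_nhdsGT (sub_pos.2 hv)] with θ hθ hmem
    linarith [hvA _ hmem, hθ.2]
  obtain ⟨θ, hθ, hθ0, hθ1⟩ := (hθ.and (Ioo_mem_nhdsGT one_pos)).exists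
  have hK : ∀ᶠ K : ℝ in nhdsWithin 0 (Set.Ioi 0), ∀ k ∈ Finset.Icc 1 m,
      ∀ w : Finset (Fin (s + m + 1)) → ℤ, (∀ S, S.card ≠ k → w S = 0) →
        pibullNorm s (fun S => (w S : ℝ)) ≠ 0 →
        K * pibullNorm s (fun S => (w S : ℝ)) ^ (-((((s + m : ℕ) : ℝ) - θ) + 1 - k) / k) ≤
          RAcNorm A (fun S => (w S : ℝ)) := by
    rw [Filter.eventually_all_finset]
    intro k hk
    have hkm : (k : ℝ) ≤ m := by exact_mod_cast (Finset.mem_Icc.1 hk).2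
    obtain ⟨K, hK, h⟩ := exists_RAcNorm_lower_bound
      (by push_cast; linarith) (by push_cast; linarith) (hθ k hk)
    filter_upwards [Ioc_mem_nhdsGT hK] with K' hK' w hw hne
    refine le_trans ?_ (h w hw hne)
    gcongr
    · exact Real.rpow_nonneg (Real.sqrt_nonneg _) _
    · exact hK'.2
  obtain ⟨K, hK, hK0⟩ := (hK.and self_mem_nhdsWithin).exists
  exact ⟨θ, hθ0, K, hK0, fun k hk1 hkm => hK k (Finset.mem_Icc.2 ⟨hk1, hkm⟩)⟩

end
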